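/- Let (L(t)) be a C0-semigroup on H with ‖L(t)‖ ≤ M e^{λ₀ t} (M ≥ 1, λ₀ > 0), and let g : [0,∞) → H be weakly continuous with g(0) = 0, g(t+s) = L(t)g(s) + g(t) for all s,t ≥ 0, and ‖g(t)‖ ≤ C e^{λ₀ t}. Fix λ > λ₀ and define the bounded operator R(λ)x = ∫₀^∞ e^{−λ t} L(t)x dt and ĝ(λ) = ∫₀^∞ e^{−λ t} g(t) dt ∈ H (Bochner integrals). Then (1/s) R(λ) g(s) converges weakly in H to λ ĝ(λ) as s ↓ 0, i.e. for every h ∈ H: lim_{s↓0} ⟨ (1/s) R(λ) g(s), h ⟩ = λ ⟨ ĝ(λ), h ⟩. -/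

import Mathlib

open Set Filter
open scoped InnerProductSpace

open MeasureTheory Topology

/-- An orthonormal family in a separable inner product space is countable. -/
theorem Orthonormal.countable_of_separableSpace {ι H : Type*} [NormedAddCommGroup H]
    [InnerProductSpace ℝ H] [TopologicalSpace.SeparableSpace H] {v : ι → H}
    (hv : Orthonormal ℝ v) : Countable ι := by
  refine Pairwise.countable_of_isOpen_disjoint (s := fun i => Metric.ball (v i) (1 / 2)) ?_
    (fun _ => Metric.isOpen_ball) (fun i => ⟨v i, Metric.mem_ball_self (by norm_num)⟩)
  intro i j hij
  refine Metric.ball_disjoint_ball ?_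
  have hsq : ‖v i - v j‖ ^ 2 = 2 := by
    rw [norm_sub_sq_real, hv.1 i, hv.1 j, hv.2 hij]
    norm_num
  rw [dist_eq_norm]
  nlinarith [norm_nonneg (v i - v j)]

/-- Pettis' theorem in a separable Hilbert space: weak measurability implies strong
measurability. -/
theorem aestronglyMeasurable_of_forall_inner {α H : Type*} [MeasurableSpace α] {μ : Measure α}
    [NormedAddCommGroup H] [InnerProductSpace ℝ H] [CompleteSpace H]
    [TopologicalSpace.SeparableSpace H] {g : α → H}
    (hg : ∀ h : H, AEStronglyMeasurable (fun t => ⟪g t, h⟫_ℝ) μ) :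
    AEStronglyMeasurable g μ := by
  obtain ⟨w, b, -⟩ := exists_hilbertBasis ℝ H
  have : Countable w := b.orthonormal.countable_of_separableSpace
  refine aestronglyMeasurable_of_tendsto_ae (u := (atTop : Filter (Finset w)))
    (f := fun F t => ∑ i ∈ F, ⟪g t, b i⟫_ℝ • b i) (fun F => ?_) (Eventually.of_forall fun t => ?_)
  · exact Finset.aestronglyMeasurable_fun_sum F fun i _ => (hg (b i)).smul_const (b i)
  · have h := b.hasSum_repr (g t)
    simp only [b.repr_apply_apply, real_inner_comm] at h
    exact h

/-- An exponentially bounded function has a convergent Laplace integral. -/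
theorem integrableOn_exp_neg_smul_of_norm_le {E : Type*} [NormedAddCommGroup E] [NormedSpace ℝ E]
    {u : ℝ → E} (hu : AEStronglyMeasurable u (volume.restrict (Ioi 0))) {K a c : ℝ}
    (hbound : ∀ t ≥ (0 : ℝ), ‖u t‖ ≤ K * Real.exp (a * t)) (hac : a < c) :
    IntegrableOn (fun t => Real.exp (-c * t) • u t) (Ioi 0) := by
  have hexp : Continuous fun t : ℝ => Real.exp (-c * t) := by fun_prop
  refine Integrable.mono' ((integrableOn_exp_mul_Ioi (sub_neg.2 hac) 0).const_mul K)
    (hexp.aestronglyMeasurable.smul hu) ?_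
  refine (ae_restrict_iff' measurableSet_Ioi).2 (Eventually.of_forall fun t ht => ?_)
  rw [norm_smul, Real.norm_eq_abs, Real.abs_exp]
  calc Real.exp (-c * t) * ‖u t‖ ≤ Real.exp (-c * t) * (K * Real.exp (a * t)) := by
        gcongr
        exact hbound t (le_of_lt ht)
    _ = K * Real.exp ((a - c) * t) := by
        rw [mul_left_comm, ← Real.exp_add]
        ring_nf

/-- The Laplace transform of a translate. -/
theorem integral_exp_neg_mul_translate (f : ℝ → ℝ) (c s : ℝ) :
    ∫ t in Ioi (0 : ℝ), Real.exp (-c * t) * f (t + s) =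
      Real.exp (c * s) * ∫ t in Ioi s, Real.exp (-c * t) * f t := by
  have h := (measurePreserving_add_right volume s).setIntegral_preimage_emb
    (measurableEmbedding_addRight s) (fun t => Real.exp (-c * t) * f t) (Ioi s)
  rw [← h, ← integral_const_mul]
  simp only [preimage_add_const_Ioi, sub_self]
  refine integral_congr_ae (Eventually.of_forall fun t => ?_)
  simp only
  rw [← mul_assoc, ← Real.exp_add]
  ring_nf

/-- The translate of a Laplace-integrable function is Laplace-integrable. -/
theorem integrableOn_exp_neg_mul_translate {f : ℝ → ℝ} {c s : ℝ} (hs : 0 ≤ s)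
    (hf : IntegrableOn (fun t => Real.exp (-c * t) * f t) (Ioi 0)) :
    IntegrableOn (fun t => Real.exp (-c * t) * f (t + s)) (Ioi 0) := by
  have h := ((measurePreserving_add_right volume s).integrableOn_comp_preimage
    (measurableEmbedding_addRight s) (f := fun t => Real.exp (-c * t) * f t) (s := Ioi s)).2
    (hf.mono_set (Ioi_subset_Ioi hs))
  simp only [preimage_add_const_Ioi, sub_self] at h
  refine (h.const_mul (Real.exp (c * s))).congr (Eventually.of_forall fun t => ?_)
  simp only [Function.comp]
  rw [← mul_assoc, ← Real.exp_add]
  ring_nf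

/-- The Laplace transform of the difference quotient of a function vanishing at `0` converges to
`c` times its Laplace transform. -/
theorem tendsto_laplace_difference_quotient {f : ℝ → ℝ} {c : ℝ} (hf : ContinuousOn f (Ici 0))
    (hf0 : f 0 = 0) (hint : IntegrableOn (fun t => Real.exp (-c * t) * f t) (Ioi 0)) :
    Tendsto (fun s : ℝ => (1 / s) * ∫ t in Ioi (0 : ℝ), Real.exp (-c * t) * (f (t + s) - f t))
      (𝓝[>] 0) (𝓝 (c * ∫ t in Ioi (0 : ℝ), Real.exp (-c * t) * f t)) := by
  set φ : ℝ → ℝ := fun t => Real.exp (-c * t) * f t with hφ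
  set F : ℝ := ∫ t in Ioi (0 : ℝ), φ t with hF
  have hφc : ContinuousOn φ (Ici 0) :=
    (by fun_prop : Continuous fun t : ℝ => Real.exp (-c * t)).continuousOn.mul hf
  have hprim : HasDerivWithinAt (fun s => ∫ t in (0 : ℝ)..s, φ t) (φ 0) (Ici 0) 0 :=
    intervalIntegral.integral_hasDerivWithinAt_right (t := Ioi 0) IntervalIntegrable.refl
      ⟨Ioi 0, self_mem_nhdsWithin, hint.aestronglyMeasurable⟩
      ((hφc 0 self_mem_Ici).mono Ioi_subset_Ici_self)
  have hexp : HasDerivWithinAt (fun s => Real.exp (c * s)) c (Ici 0) 0 := by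
    simpa using (((hasDerivAt_id (0 : ℝ)).const_mul c).exp).hasDerivWithinAt (s := Ici 0)
  have hderiv := ((hexp.mul (hprim.const_sub F)).sub_const F).mono Ioi_subset_Ici_self
  rw [hasDerivWithinAt_iff_tendsto_slope' self_notMem_Ioi] at hderiv
  have hval : φ 0 = 0 := by simp [hφ, hf0]
  simp only [intervalIntegral.integral_same, sub_zero, hval, neg_zero, mul_zero, add_zero]
    at hderiv
  refine hderiv.congr' ?_
  filter_upwards [self_mem_nhdsWithin] with s hs
  have hs0 : (0 : ℝ) ≤ s := le_of_lt hs
  have hsplit : ∫ t in Ioi (0 : ℝ), Real.exp (-c * t) * (f (t + s) - f t) =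
      Real.exp (c * s) * (F - ∫ t in (0 : ℝ)..s, φ t) - F := by
    rw [← intervalIntegral.integral_Ioi_sub_Ioi hint hs0, sub_sub_cancel,
      ← integral_exp_neg_mul_translate, hF, ← integral_sub
        (integrableOn_exp_neg_mul_translate hs0 hint) hint]
    simp only [hφ, mul_sub]
  rw [hsplit]
  simp [slope_def_field, div_eq_inv_mul]

/-- key limit in Lemma 3.5: with `R(λ)x = ∫₀^∞ e^{−λt} L(t)x dt` and
`ĝ(λ) = ∫₀^∞ e^{−λt} g(t) dt`, one has `(1/s) R(λ) g(s) ⇀ λ ĝ(λ)` weakly as `s ↓ 0`. -/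
theorem resolvent_of_cocycle_weak_limit
    {H : Type} [NormedAddCommGroup H] [InnerProductSpace ℝ H] [CompleteSpace H]
    [TopologicalSpace.SeparableSpace H]
    -- a C₀-semigroup L with exponential bound
    (L : ℝ → H →L[ℝ] H)
    (hL0 : L 0 = ContinuousLinearMap.id ℝ H)
    (hLsem : ∀ s ≥ (0:ℝ), ∀ t ≥ (0:ℝ), L (s + t) = (L s).comp (L t))
    (hLcont : ∀ x : H, ContinuousOn (fun t => L t x) (Ici 0))
    (M lam₀ : ℝ) (hM : 1 ≤ M) (hlam₀ : 0 < lam₀)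
    (hLbound : ∀ t ≥ (0:ℝ), ‖L t‖ ≤ M * Real.exp (lam₀ * t))
    -- a weakly continuous cocycle g with exponential bound
    (g : ℝ → H) (hg0 : g 0 = 0)
    (hgw : ∀ h : H, ContinuousOn (fun t => ⟪g t, h⟫_ℝ) (Ici 0))
    (hgcoc : ∀ s ≥ (0:ℝ), ∀ t ≥ (0:ℝ), g (t + s) = L t (g s) + g t)
    (C : ℝ) (hgbound : ∀ t ≥ (0:ℝ), ‖g t‖ ≤ C * Real.exp (lam₀ * t))
    -- λ > λ₀, the resolvent R(λ) and the Laplace transform ĝ(λ)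
    (lam : ℝ) (hlam : lam₀ < lam)
    (R : H →L[ℝ] H)
    (hR : ∀ x : H, R x = ∫ t in Ioi (0:ℝ), Real.exp (-lam * t) • L t x)
    (ghat : H)
    (hghat : ghat = ∫ t in Ioi (0:ℝ), Real.exp (-lam * t) • g t) :
    ∀ h : H,
      Tendsto (fun s : ℝ => ⟪(1 / s) • R (g s), h⟫_ℝ)
        (nhdsWithin 0 (Ioi 0)) (nhds (lam * ⟪ghat, h⟫_ℝ)) := by
  intro h
  have hgint : IntegrableOn (fun t => Real.exp (-lam * t) • g t) (Ioi 0) :=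
    integrableOn_exp_neg_smul_of_norm_le (aestronglyMeasurable_of_forall_inner fun k =>
      ((hgw k).mono Ioi_subset_Ici_self).aestronglyMeasurable measurableSet_Ioi) hgbound hlam
  have hLint : ∀ x, IntegrableOn (fun t => Real.exp (-lam * t) • L t x) (Ioi 0) := fun x =>
    integrableOn_exp_neg_smul_of_norm_le (K := M * ‖x‖)
      (((hLcont x).mono Ioi_subset_Ici_self).aestronglyMeasurable measurableSet_Ioi)
      (fun t ht => by
        calc ‖L t x‖ ≤ M * Real.exp (lam₀ * t) * ‖x‖ := (L t).le_of_opNorm_le (hLbound t ht) x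
          _ = M * ‖x‖ * Real.exp (lam₀ * t) := by ring) hlam
  have hpair : ∀ u : ℝ → H, IntegrableOn (fun t => Real.exp (-lam * t) • u t) (Ioi 0) →
      ⟪∫ t in Ioi (0 : ℝ), Real.exp (-lam * t) • u t, h⟫_ℝ =
        ∫ t in Ioi (0 : ℝ), Real.exp (-lam * t) * ⟪u t, h⟫_ℝ := fun u hu => by
    rw [real_inner_comm, ← integral_inner hu]
    simp only [real_inner_smul_right, real_inner_comm]
  have hfint : IntegrableOn (fun t => Real.exp (-lam * t) * ⟪g t, h⟫_ℝ) (Ioi 0) := by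
    have hinner := Integrable.inner_const (𝕜 := ℝ) hgint h
    simp only [real_inner_smul_left] at hinner
    exact hinner
  have hlim := tendsto_laplace_difference_quotient (hgw h) (by simp [hg0]) hfint
  rw [hghat, hpair g hgint]
  refine hlim.congr' ?_
  filter_upwards [self_mem_nhdsWithin] with s hs
  rw [real_inner_smul_left, hR, hpair _ (hLint (g s))]
  congr 1
  refine setIntegral_congr_fun measurableSet_Ioi fun t ht => ?_
  simp only [hgcoc s (le_of_lt hs) t (le_of_lt ht), inner_add_left, add_sub_cancel_right]
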